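/- arXiv:1811.10069 — 2 statements merged into one kernel-verified Lean document; each statement's English description precedes it below -/
import Mathlib

section
/- Let k be an algebraically closed field, let a, c, B, C ∈ k, and let T = T(a, (1-a)(2-B), c, -1, 0, 1; 1, B, C, 0, -1, 0). Then each of the generators x, y, z of T is left and right regular: for every g ∈ {x, y, z} and every t ∈ T, if g·t = 0 then t = 0, and if t·g = 0 then t = 0. -/
noncomputable section

open FreeAlgebra

/-- The generator `x` of the free algebra `k⟨x,y,z⟩`. -/
def Xf (k : Type*) [Field k] : FreeAlgebra k (Fin 3) := FreeAlgebra.ι k 0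

/-- The generator `y` of the free algebra `k⟨x,y,z⟩`. -/
def Yf (k : Type*) [Field k] : FreeAlgebra k (Fin 3) := FreeAlgebra.ι k 1

/-- The generator `z` of the free algebra `k⟨x,y,z⟩`. -/
def Zf (k : Type*) [Field k] : FreeAlgebra k (Fin 3) := FreeAlgebra.ι k 2

/-- The relations defining `T(a,b,c,d,e,f; A,B,C,D,E,F)`: `xy = yx`,
`zx = a·x² + b·xy + c·y² + d·xz + e·yz + f·z²`, and
`zy = A·x² + B·xy + C·y² + D·xz + E·yz + F·z²`. -/
def Trel (k : Type*) [Field k] (a b c d e f A B C D E F : k) :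
    FreeAlgebra k (Fin 3) → FreeAlgebra k (Fin 3) → Prop := fun m n =>
  (m = Xf k * Yf k ∧ n = Yf k * Xf k) ∨
  (m = Zf k * Xf k ∧
    n = a • (Xf k) ^ 2 + b • (Xf k * Yf k) + c • (Yf k) ^ 2 +
        d • (Xf k * Zf k) + e • (Yf k * Zf k) + f • (Zf k) ^ 2) ∨
  (m = Zf k * Yf k ∧
    n = A • (Xf k) ^ 2 + B • (Xf k * Yf k) + C • (Yf k) ^ 2 +
        D • (Xf k * Zf k) + E • (Yf k * Zf k) + F • (Zf k) ^ 2)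

/-- The algebra `T(a,b,c,d,e,f; A,B,C,D,E,F)`. -/
abbrev Talg (k : Type*) [Field k] (a b c d e f A B C D E F : k) :=
  RingQuot (Trel k a b c d e f A B C D E F)

/-- The image of `x` in `T`. -/
def Tx (k : Type*) [Field k] (a b c d e f A B C D E F : k) :
    Talg k a b c d e f A B C D E F :=
  RingQuot.mkAlgHom k (Trel k a b c d e f A B C D E F) (Xf k)

/-- The image of `y` in `T`. -/
def Ty (k : Type*) [Field k] (a b c d e f A B C D E F : k) :
    Talg k a b c d e f A B C D E F :=
  RingQuot.mkAlgHom k (Trel k a b c d e f A B C D E F) (Yf k)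

/-- The image of `z` in `T`. -/
def Tz (k : Type*) [Field k] (a b c d e f A B C D E F : k) :
    Talg k a b c d e f A B C D E F :=
  RingQuot.mkAlgHom k (Trel k a b c d e f A B C D E F) (Zf k)

/-- The property that the family `(i,j,l) ↦ y^i x^j z^l` is a `k`-vector-space basis of `T`;
following the paper, this is exactly the condition that `T` is a graded twisted tensor
product of `k[x,y]` and `k[z]`. -/
def ThasBasis (k : Type*) [Field k] (a b c d e f A B C D E F : k) : Prop :=
  LinearIndependent k
      (fun p : ℕ × ℕ × ℕ =>
        (Ty k a b c d e f A B C D E F) ^ p.1 * (Tx k a b c d e f A B C D E F) ^ p.2.1 *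
          (Tz k a b c d e f A B C D E F) ^ p.2.2) ∧
    Submodule.span k
      (Set.range fun p : ℕ × ℕ × ℕ =>
        (Ty k a b c d e f A B C D E F) ^ p.1 * (Tx k a b c d e f A B C D E F) ^ p.2.1 *
          (Tz k a b c d e f A B C D E F) ^ p.2.2) = ⊤

open Matrix MvPolynomial in
/-- The polynomial `x² + βxy + γy²`. -/
def omegaPoly {k : Type*} [Field k] (β γ : k) : MvPolynomial (Fin 3) k :=
  X 0 ^ 2 + C β * X 0 * X 1 + C γ * X 1 ^ 2

open Matrix MvPolynomial in
/-- Right multiplication by `x` in the basis `1, q, v, qv`. -/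
def matX {k : Type*} [Field k] (β γ : k) : Matrix (Fin 4) (Fin 4) (MvPolynomial (Fin 3) k) :=
  !![X 0, 0, 0, 0;
    -(C β * omegaPoly β γ * X 0), X 0 + C β * X 1, 0, 0;
    0, 1, -X 0, 0;
    X 2, -(C β * omegaPoly β γ), C β * omegaPoly β γ * X 0, -(X 0 + C β * X 1)]

open Matrix MvPolynomial in
/-- Right multiplication by `y` in the basis `1, q, v, qv`. -/
def matY {k : Type*} [Field k] (β γ : k) : Matrix (Fin 4) (Fin 4) (MvPolynomial (Fin 3) k) :=
  !![X 1, 0, 0, 0;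
    2 * omegaPoly β γ * X 0, -X 1, 0, 0;
    omegaPoly β γ, 0, -X 1, 0;
    0, omegaPoly β γ, -(2 * omegaPoly β γ * X 0), X 1]

open Matrix MvPolynomial in
/-- Right multiplication by `v` in the basis `1, q, v, qv`. -/
def matV {k : Type*} [Field k] (l : k) : Matrix (Fin 4) (Fin 4) (MvPolynomial (Fin 3) k) :=
  !![0, 0, 1, 0;
    0, 0, 0, 1;
    C l * X 1 ^ 2, 0, 0, 0;
    0, C l * X 1 ^ 2, 0, 0]

section MatrixRelations

variable {k : Type*} [Field k] (β γ l : k)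

lemma matX_mul_matY : matX β γ * matY β γ = matY β γ * matX β γ := by
  ext1 i j
  fin_cases i <;> fin_cases j <;>
    simp [matX, matY, omegaPoly, Matrix.mul_apply, Fin.sum_univ_four] <;> ring

lemma matV_mul_matV : matV l * matV l = l • (matY β γ * matY β γ) := by
  ext1 i j
  fin_cases i <;> fin_cases j <;>
    simp [matV, matY, omegaPoly, Matrix.mul_apply, Fin.sum_univ_four,
      MvPolynomial.smul_eq_C_mul, -mul_eq_mul_left_iff] <;> ring

set_option maxHeartbeats 1000000 in
lemma matV_mul_matY :
    matV l * matY β γ = matX β γ * matX β γ + β • (matY β γ * matX β γ) +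
      γ • (matY β γ * matY β γ) - matY β γ * matV l := by
  ext1 i j
  fin_cases i <;> fin_cases j <;>
    simp [matV, matX, matY, omegaPoly, Matrix.mul_apply, Fin.sum_univ_four,
      MvPolynomial.smul_eq_C_mul] <;> ring

/-- A matrix of polynomials whose determinant is nonzero at some point cancels on both sides. -/
lemma mul_cancel_of_det_eval_ne_zero {σ n : Type*} [Fintype n] [DecidableEq n]
    (M : Matrix n n (MvPolynomial σ k)) (p : σ → k)
    (h : (M.map (MvPolynomial.eval p)).det ≠ 0) (N : Matrix n n (MvPolynomial σ k)) :
    (M * N = 0 → N = 0) ∧ (N * M = 0 → N = 0) := by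
  have hdet : M.det ≠ 0 := by
    intro h0
    apply h
    have := RingHom.map_det (MvPolynomial.eval p) M
    rw [h0, map_zero] at this
    exact this.symm
  constructor
  · intro hN
    have h1 : M.adjugate * (M * N) = M.det • N := by
      rw [← Matrix.mul_assoc, Matrix.adjugate_mul, Matrix.smul_mul, Matrix.one_mul]
    rw [hN, Matrix.mul_zero] at h1
    exact (smul_eq_zero.mp h1.symm).resolve_left hdet
  · intro hN
    have h1 : N * M * M.adjugate = M.det • N := by
      rw [Matrix.mul_assoc, Matrix.mul_adjugate, Matrix.mul_smul, Matrix.mul_one]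
    rw [hN, Matrix.zero_mul] at h1
    exact (smul_eq_zero.mp h1.symm).resolve_left hdet

lemma det_matX_eval : ((matX β γ).map (MvPolynomial.eval ![1, 0, 0])).det ≠ 0 := by
  have : (matX β γ).map (MvPolynomial.eval ![1, 0, 0]) =
      !![1, 0, 0, 0; -β, 1, 0, 0; 0, 1, -1, 0; 0, -β, β, -1] := by
    ext i j
    fin_cases i <;> fin_cases j <;> simp [matX, omegaPoly]
  rw [this]
  simp [Matrix.det_succ_row_zero, Fin.sum_univ_succ, Fin.succAbove]

lemma det_matY_eval : ((matY β γ).map (MvPolynomial.eval ![0, 1, 0])).det ≠ 0 := by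
  have : (matY β γ).map (MvPolynomial.eval ![0, 1, 0]) =
      !![1, 0, 0, 0; 0, -1, 0, 0; γ, 0, -1, 0; 0, γ, 0, 1] := by
    ext i j
    fin_cases i <;> fin_cases j <;> simp [matY, omegaPoly]
  rw [this]
  simp [Matrix.det_succ_row_zero, Fin.sum_univ_succ, Fin.succAbove]

lemma det_matZ_eval (s : k) :
    ((matV l + matX β γ + s • matY β γ).map (MvPolynomial.eval ![0, 0, 1])).det ≠ 0 := by
  have : (matV l + matX β γ + s • matY β γ).map (MvPolynomial.eval ![0, 0, 1]) =
      !![0, 0, 1, 0; 0, 0, 0, 1; 0, 1, 0, 0; 1, 0, 0, 0] := by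
    ext i j
    fin_cases i <;> fin_cases j <;> simp [matV, matX, matY, omegaPoly]
  rw [this]
  simp [Matrix.det_succ_row_zero, Fin.sum_univ_succ, Fin.succAbove]

end MatrixRelations

open scoped IsMulCommutative in
/-- Three pairwise commuting elements of an algebra are the images of the variables under an
algebra map out of the polynomial ring. -/
lemma exists_algHom_of_commute {k A : Type*} [Field k] [Ring A] [Algebra k A] (x y t : A)
    (hxy : Commute x y) (hxt : Commute x t) (hyt : Commute y t) :
    ∃ i : MvPolynomial (Fin 3) k →ₐ[k] A,
      i (MvPolynomial.X 0) = x ∧ i (MvPolynomial.X 1) = y ∧ i (MvPolynomial.X 2) = t := by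
  let s : Set A := {x, y, t}
  have hs : ∀ a ∈ s, ∀ b ∈ s, a * b = b * a := by
    rintro a (rfl | rfl | rfl) b (rfl | rfl | rfl) <;>
      first | rfl | assumption | (symm; assumption)
  have := Algebra.isMulCommutative_adjoin k hs
  let f : Fin 3 → Algebra.adjoin k s :=
    ![⟨x, Algebra.subset_adjoin (by simp [s])⟩, ⟨y, Algebra.subset_adjoin (by simp [s])⟩,
      ⟨t, Algebra.subset_adjoin (by simp [s])⟩]
  refine ⟨(Algebra.adjoin k s).val.comp (MvPolynomial.aeval f), ?_, ?_, ?_⟩ <;> simp [f]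

section Relations

variable {k A : Type*} [Field k] [Ring A] [Algebra k A] {β γ l : k} {x y v : A}

/-- Multiplying the vector `(1, q, v, qv)` on the right by `x`, `y` or `v` amounts to applying the
corresponding matrix, its entries being evaluated at `x`, `y` and the central element
`q² + β(x² + βxy + γy²)q`, where `q = xv + vx`. -/
lemma exists_algHom_basis (hxy : x * y = y * x) (hv : v * v = l • (y * y))
    (hyv : v * y = x * x + β • (y * x) + γ • (y * y) - y * v) :
    ∃ (i : MvPolynomial (Fin 3) k →ₐ[k] A) (b : Fin 4 → A), b 0 = 1 ∧
      (∀ r, b r * x = ∑ j, i (matX β γ r j) * b j) ∧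
      (∀ r, b r * y = ∑ j, i (matY β γ r j) * b j) ∧
      (∀ r, b r * v = ∑ j, i (matV l r j) * b j) := by
  obtain ⟨w, hw⟩ : ∃ w, w = x * x + β • (y * x) + γ • (y * y) := ⟨_, rfl⟩
  obtain ⟨q, hq⟩ : ∃ q, q = x * v + v * x := ⟨_, rfl⟩
  rw [← hw] at hyv
  have hvx : v * x = q - x * v := by rw [hq]; abel
  have hxy' : Commute x y := hxy
  have hwx : Commute w x := by
    rw [hw]
    exact (((Commute.refl x).mul_left (Commute.refl x)).add_left
      ((hxy'.symm.mul_left (Commute.refl x)).smul_left β)).add_left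
      ((hxy'.symm.mul_left hxy'.symm).smul_left γ)
  have hwy : Commute w y := by
    rw [hw]
    exact ((hxy'.mul_left hxy').add_left (((Commute.refl y).mul_left hxy').smul_left β)).add_left
      (((Commute.refl y).mul_left (Commute.refl y)).smul_left γ)
  have hyyv : Commute (y * y) v := by
    have : v * (y * y) = y * y * v := by
      rw [← mul_assoc, hyv, sub_mul, mul_assoc y v y, hyv, hwy.eq]
      noncomm_ring
    exact this.symm
  have hvvx : Commute (v * v) x := by
    rw [hv]; exact (hxy'.symm.mul_left hxy'.symm).smul_left l
  have hvvy : Commute (v * v) y := by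
    rw [hv]; exact ((Commute.refl y).mul_left (Commute.refl y)).smul_left l
  have hwv : Commute w v := by
    have h1 : w = v * y + y * v := by rw [hyv]; abel
    have h2 : v * v * y = y * (v * v) := hvvy
    change w * v = v * w
    rw [h1, mul_add, add_mul, ← mul_assoc v v y, h2]
    noncomm_ring
  have hqv : q * v = v * q := by
    have h2 : v * v * x = x * (v * v) := hvvx
    rw [hq, mul_add, add_mul, ← mul_assoc v v x, h2]
    noncomm_ring
  have hwq : Commute w q := by
    rw [hq]; exact (hwx.mul_right hwv).add_right (hwv.mul_right hwx)
  have hqy : q * y = 2 * w * x - y * q := by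
    have h1 : q * y = x * (v * y) + v * y * x := by
      rw [hq, add_mul, mul_assoc v x y, hxy, mul_assoc, mul_assoc v y x]
    have h2 : x * y * v = y * x * v := by rw [hxy]
    rw [h1, hyv, hq, mul_sub, sub_mul, ← hwx.eq, ← mul_assoc x y v, h2]
    noncomm_ring
  have hqx : q * x = (x + β • y) * q - β • (w * x) := by
    have h1 : v * (x * x) = x * x * v + β • (y * x * v) - β • (v * (y * x)) := by
      have h3 : x * x = w - β • (y * x) - γ • (y * y) := by rw [hw]; abel
      rw [h3]
      simp only [mul_sub, sub_mul, mul_smul_comm, smul_mul_assoc, hwv.eq, hyyv.eq]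
      abel
    have h2 : q * x = x * (v * x) + v * (x * x) := by rw [hq]; noncomm_ring
    rw [h2, h1, ← mul_assoc v y x, hyv, hq]
    simp only [mul_add, add_mul, sub_mul, smul_mul_assoc, mul_assoc, smul_sub]
    abel
  obtain ⟨t, ht⟩ : ∃ t, t = q * q + β • (w * q) := ⟨_, rfl⟩
  have hqq : q * q = t - β • (w * q) := by rw [ht]; abel
  have hqy' : q * y = w * x + w * x - y * q := by rw [hqy, mul_assoc, two_mul]
  have hqy_assoc (s : A) : q * (y * s) = w * (x * s) + w * (x * s) - y * (q * s) := by
    rw [← mul_assoc, hqy']; noncomm_ring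
  have hqx_assoc (s : A) : q * (x * s) = x * (q * s) + β • (y * (q * s)) - β • (w * (x * s)) := by
    rw [← mul_assoc, hqx]
    simp only [add_mul, sub_mul, smul_mul_assoc, mul_assoc]
  have hqw_assoc (s : A) : q * (w * s) = w * (q * s) := by rw [← mul_assoc, ← hwq.eq, mul_assoc]
  have hyw_assoc (s : A) : y * (w * s) = w * (y * s) := by rw [← mul_assoc, ← hwy.eq, mul_assoc]
  have hxw_assoc (s : A) : x * (w * s) = w * (x * s) := by rw [← mul_assoc, ← hwx.eq, mul_assoc]
  have hty : Commute t y := by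
    change t * y = y * t
    rw [ht]
    simp only [mul_add, add_mul, mul_sub, smul_mul_assoc, mul_smul_comm, mul_assoc,
      hqy', hqx, hqy_assoc, hqw_assoc, hyw_assoc]
    module
  have htx : Commute t x := by
    change t * x = x * t
    rw [ht]
    simp only [mul_add, add_mul, mul_sub, smul_mul_assoc, mul_smul_comm, mul_assoc,
      hqx, hqy_assoc, hqx_assoc, hqw_assoc, hxw_assoc]
    module
  obtain ⟨i, hi0, hi1, hi2⟩ := exists_algHom_of_commute (k := k) x y t hxy' htx.symm hty.symm
  have hiw : i (omegaPoly β γ) = w := by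
    simp [omegaPoly, hi0, hi1, hw, pow_two, Algebra.smul_def, hxy, mul_assoc]
  have hi2' : i 2 = 2 := map_ofNat i 2
  have hiC (s : k) : i (MvPolynomial.C s) = algebraMap k A s := i.commutes s
  refine ⟨i, ![1, q, v, q * v], rfl, ?_, ?_, ?_⟩
  · intro r
    fin_cases r
    · simp [Fin.sum_univ_four, matX, hi0]
    · simp [Fin.sum_univ_four, matX, hi0, hi1, hiw, hiC, hqx, Algebra.smul_def, mul_assoc]
      abel
    · simp [Fin.sum_univ_four, matX, hi0, hvx]
      abel
    · simp [Fin.sum_univ_four, matX, hi0, hi1, hi2, hiw, hiC]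
      rw [mul_assoc, hvx, mul_sub, ← mul_assoc, hqx, hqq]
      simp only [Algebra.smul_def, add_mul, sub_mul, neg_mul, mul_assoc]
      abel
  · intro r
    fin_cases r
    · simp [Fin.sum_univ_four, matY, hi1]
    · simp [Fin.sum_univ_four, matY, hi0, hi1, hiw, hi2', hqy]
      abel
    · simp [Fin.sum_univ_four, matY, hi1, hiw, hyv]
      abel
    · simp [Fin.sum_univ_four, matY, hi0, hi1, hiw, hi2']
      rw [mul_assoc, hyv, mul_sub, ← mul_assoc, hqy, ← hwq.eq]
      noncomm_ring
  · have hqyy : q * (y * y) = y * y * q := by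
      have h2 : y * (w * x) = w * x * y := ((hwy.mul_left hxy').eq).symm
      rw [← mul_assoc, hqy, sub_mul, mul_assoc y q y, hqy, mul_sub, mul_assoc 2 w x,
        mul_assoc 2 (w * x) y, ← h2]
      noncomm_ring
    intro r
    fin_cases r
    · simp [Fin.sum_univ_four, matV]
    · simp [Fin.sum_univ_four, matV]
    · simp [Fin.sum_univ_four, matV, hi1, hiC, hv, Algebra.smul_def, pow_two]
    · simp [Fin.sum_univ_four, matV, hi1, hiC]
      rw [mul_assoc, hv, mul_smul_comm, hqyy, Algebra.smul_def, pow_two]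
      simp only [mul_assoc]

end Relations

/-- In `T = T(a, (1-a)(2-B), c, -1, 0, 1; 1, B, C, 0, -1, 0)`, each of the generators
`x`, `y`, `z` is left and right regular. -/
theorem stmt16 {k : Type*} [Field k] [IsAlgClosed k] (a c B C : k) :
    ∀ g : Talg k a ((1 - a) * (2 - B)) c (-1) 0 1 1 B C 0 (-1) 0,
      (g = Tx k a ((1 - a) * (2 - B)) c (-1) 0 1 1 B C 0 (-1) 0 ∨
       g = Ty k a ((1 - a) * (2 - B)) c (-1) 0 1 1 B C 0 (-1) 0 ∨
       g = Tz k a ((1 - a) * (2 - B)) c (-1) 0 1 1 B C 0 (-1) 0) →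
      ∀ t : Talg k a ((1 - a) * (2 - B)) c (-1) 0 1 1 B C 0 (-1) 0,
        (g * t = 0 → t = 0) ∧ (t * g = 0 → t = 0) := by
  obtain ⟨x, hx⟩ : ∃ x, x = Tx k a ((1 - a) * (2 - B)) c (-1) 0 1 1 B C 0 (-1) 0 := ⟨_, rfl⟩
  obtain ⟨y, hy⟩ : ∃ y, y = Ty k a ((1 - a) * (2 - B)) c (-1) 0 1 1 B C 0 (-1) 0 := ⟨_, rfl⟩
  obtain ⟨z, hz⟩ : ∃ z, z = Tz k a ((1 - a) * (2 - B)) c (-1) 0 1 1 B C 0 (-1) 0 := ⟨_, rfl⟩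
  have hxy : x * y = y * x := by
    have := RingQuot.mkAlgHom_rel k
      (s := Trel k a ((1 - a) * (2 - B)) c (-1) 0 1 1 B C 0 (-1) 0) (Or.inl ⟨rfl, rfl⟩)
    simpa only [map_mul, hx, hy, Tx, Ty] using this
  have hzx : z * x = a • (x * x) + ((1 - a) * (2 - B)) • (y * x) + c • (y * y) - x * z +
      z * z := by
    have := RingQuot.mkAlgHom_rel k
      (s := Trel k a ((1 - a) * (2 - B)) c (-1) 0 1 1 B C 0 (-1) 0)
      (Or.inr (Or.inl ⟨rfl, rfl⟩))
    simp only [map_mul, map_add, map_smul, map_pow] at this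
    rw [← hxy, hz, hx, hy, Tx, Ty, Tz, this]
    simp only [pow_two]
    module
  have hzy : z * y = x * x + B • (y * x) + C • (y * y) - y * z := by
    have := RingQuot.mkAlgHom_rel k
      (s := Trel k a ((1 - a) * (2 - B)) c (-1) 0 1 1 B C 0 (-1) 0)
      (Or.inr (Or.inr ⟨rfl, rfl⟩))
    simp only [map_mul, map_add, map_smul, map_pow] at this
    rw [← hxy, hz, hx, hy, Tx, Ty, Tz, this]
    simp only [pow_two]
    module
  obtain ⟨β, hβ⟩ : ∃ β, β = B - 2 := ⟨_, rfl⟩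
  obtain ⟨γ, hγ⟩ : ∃ γ, γ = C - 2 * (1 - a) := ⟨_, rfl⟩
  obtain ⟨l, hl⟩ : ∃ l, l = (1 - a) ^ 2 - (1 - a) * C - c := ⟨_, rfl⟩
  obtain ⟨v, hv⟩ : ∃ v, v = z - x - (1 - a) • y := ⟨_, rfl⟩
  have hzv : z = v + x + (1 - a) • y := by rw [hv]; abel
  have hvv : v * v = l • (y * y) := by
    have hzz : z * z = z * x + x * z - a • (x * x) - ((1 - a) * (2 - B)) • (y * x)
        - c • (y * y) := by rw [hzx]; abel
    rw [hv, hl]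
    simp only [mul_sub, sub_mul, smul_mul_assoc, mul_smul_comm, hzz, hzy, hxy]
    module
  have hvy : v * y = x * x + β • (y * x) + γ • (y * y) - y * v := by
    rw [hv, hβ, hγ]
    simp only [mul_sub, sub_mul, smul_mul_assoc, mul_smul_comm, hzy, hxy]
    module
  obtain ⟨i, b, hb0, hbx, hby, hbv⟩ := exists_algHom_basis hxy hvv hvy
  obtain ⟨φ, hφx, hφy, hφz⟩ : ∃ φ : Talg k a ((1 - a) * (2 - B)) c (-1) 0 1 1 B C 0 (-1) 0 →ₐ[k]
      Matrix (Fin 4) (Fin 4) (MvPolynomial (Fin 3) k),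
      φ x = matX β γ ∧ φ y = matY β γ ∧ φ z = matV l + matX β γ + (1 - a) • matY β γ := by
    let f : FreeAlgebra k (Fin 3) →ₐ[k] Matrix (Fin 4) (Fin 4) (MvPolynomial (Fin 3) k) :=
      FreeAlgebra.lift k ![matX β γ, matY β γ, matV l + matX β γ + (1 - a) • matY β γ]
    have hfx : f (Xf k) = matX β γ := by simp [f, Xf]
    have hfy : f (Yf k) = matY β γ := by simp [f, Yf]
    have hfz : f (Zf k) = matV l + matX β γ + (1 - a) • matY β γ := by simp [f, Zf]
    have hrel : ∀ ⦃m n⦄, Trel k a ((1 - a) * (2 - B)) c (-1) 0 1 1 B C 0 (-1) 0 m n →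
        f m = f n := by
      rintro m n (⟨rfl, rfl⟩ | ⟨rfl, rfl⟩ | ⟨rfl, rfl⟩)
      · rw [map_mul, map_mul, hfx, hfy, matX_mul_matY]
      · simp only [map_mul, map_add, map_smul, hfx, hfy, hfz, pow_two]
        simp only [mul_add, add_mul, smul_mul_assoc, mul_smul_comm, matX_mul_matY,
          matV_mul_matV β γ, matV_mul_matY]
        rw [hβ, hγ, hl]
        module
      · simp only [map_mul, map_add, map_smul, hfx, hfy, hfz, pow_two]
        simp only [mul_add, add_mul, smul_mul_assoc, mul_smul_comm, matX_mul_matY,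
          matV_mul_matY]
        rw [hβ, hγ]
        module
    refine ⟨RingQuot.liftAlgHom k ⟨f, hrel⟩, ?_, ?_, ?_⟩
    · rw [hx, Tx, RingQuot.liftAlgHom_mkAlgHom_apply, hfx]
    · rw [hy, Ty, RingQuot.liftAlgHom_mkAlgHom_apply, hfy]
    · rw [hz, Tz, RingQuot.liftAlgHom_mkAlgHom_apply, hfz]
  have hmul (g : Talg k a ((1 - a) * (2 - B)) c (-1) 0 1 1 B C 0 (-1) 0) (r : Fin 4) :
      b r * g = ∑ j, i (φ g r j) * b j := by
    obtain ⟨g, rfl⟩ := RingQuot.mkAlgHom_surjective k _ g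
    induction g using FreeAlgebra.induction generalizing r with
    | grade0 s =>
      rw [AlgHom.commutes, AlgHom.commutes, ← Algebra.commutes]
      simp [Matrix.algebraMap_matrix_apply, apply_ite i, ite_mul]
    | grade1 j =>
      fin_cases j
      · change b r * Tx k _ _ _ _ _ _ _ _ _ _ _ _ =
          ∑ j, i (φ (Tx k _ _ _ _ _ _ _ _ _ _ _ _) r j) * b j
        rw [← hx, hφx, hbx]
      · change b r * Ty k _ _ _ _ _ _ _ _ _ _ _ _ =
          ∑ j, i (φ (Ty k _ _ _ _ _ _ _ _ _ _ _ _) r j) * b j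
        rw [← hy, hφy, hby]
      · change b r * Tz k _ _ _ _ _ _ _ _ _ _ _ _ =
          ∑ j, i (φ (Tz k _ _ _ _ _ _ _ _ _ _ _ _) r j) * b j
        rw [← hz, hφz, hzv, mul_add, mul_add, mul_smul_comm, hbv, hbx, hby]
        simp only [Matrix.add_apply, Matrix.smul_apply, map_add, map_smul, add_mul,
          smul_mul_assoc, Finset.sum_add_distrib, Finset.smul_sum]
    | mul g h hg hh =>
      rw [map_mul, map_mul, ← mul_assoc, hg, Finset.sum_mul]
      simp only [mul_assoc, hh, Matrix.mul_apply, map_sum, map_mul, Finset.mul_sum, Finset.sum_mul]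
      exact Finset.sum_comm
    | add g h hg hh =>
      rw [map_add, map_add, mul_add, hg, hh]
      simp only [Matrix.add_apply, map_add, add_mul, Finset.sum_add_distrib]
  have hinj (t : Talg k a ((1 - a) * (2 - B)) c (-1) 0 1 1 B C 0 (-1) 0) (ht : φ t = 0) :
      t = 0 := by
    simpa [hb0, ht] using hmul t 0
  have key (g : Talg k a ((1 - a) * (2 - B)) c (-1) 0 1 1 B C 0 (-1) 0) (p : Fin 3 → k)
      (hg : ((φ g).map (MvPolynomial.eval p)).det ≠ 0)
      (t : Talg k a ((1 - a) * (2 - B)) c (-1) 0 1 1 B C 0 (-1) 0) :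
      (g * t = 0 → t = 0) ∧ (t * g = 0 → t = 0) := by
    have h := mul_cancel_of_det_eval_ne_zero (φ g) p hg (φ t)
    exact ⟨fun h0 => hinj t (h.1 (by rw [← map_mul, h0, map_zero])),
      fun h0 => hinj t (h.2 (by rw [← map_mul, h0, map_zero]))⟩
  rw [← hx, ← hy, ← hz]
  rintro g (rfl | rfl | rfl) t
  · exact key g _ (hφx ▸ det_matX_eval β γ) t
  · exact key g _ (hφy ▸ det_matY_eval β γ) t
  · exact key g _ (hφz ▸ det_matZ_eval β γ l (1 - a)) t
end
end

section
/- Let k be an algebraically closed field of characteristic different from 2, and let a, c, B, C ∈ k. Set β = 2 - B, γ = C + 2(a-1), g = γ - β²/4, and h = c - (a-1)·(C + a - 1). Then there is a k-algebra isomorphism between T(a, (1-a)(2-B), c, -1, 0, 1; 1, B, C, 0, -1, 0) and the algebra k⟨x,y,w⟩/⟨wy + yw - x² - g·y², w² + h·y², xy - yx⟩, induced by the invertible linear change of variables x ↦ x - (β/2)·y, y ↦ y, w ↦ -x + (a-1)·y + z. -/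
noncomputable section

open FreeAlgebra

/-- The generator `w` of the free algebra `k⟨x,y,w⟩` (on the same underlying type). -/
def Wf (k : Type*) [Field k] : FreeAlgebra k (Fin 3) := FreeAlgebra.ι k 2

/-- The relations defining `k⟨x,y,w⟩/⟨wy + yw - x² - g·y², w² + h·y², xy - yx⟩`. -/
def Wrel (k : Type*) [Field k] (g h : k) :
    FreeAlgebra k (Fin 3) → FreeAlgebra k (Fin 3) → Prop := fun m n =>
  (m = Wf k * Yf k + Yf k * Wf k ∧ n = (Xf k) ^ 2 + g • (Yf k) ^ 2) ∨
  (m = (Wf k) ^ 2 ∧ n = -(h • (Yf k) ^ 2)) ∨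
  (m = Xf k * Yf k ∧ n = Yf k * Xf k)

/-- The algebra `k⟨x,y,w⟩/⟨wy + yw - x² - g·y², w² + h·y², xy - yx⟩`. -/
abbrev Walg (k : Type*) [Field k] (g h : k) := RingQuot (Wrel k g h)

/-- The image of `x` in the `W`-presentation. -/
def Wx (k : Type*) [Field k] (g h : k) : Walg k g h :=
  RingQuot.mkAlgHom k (Wrel k g h) (Xf k)

/-- The image of `y` in the `W`-presentation. -/
def Wy (k : Type*) [Field k] (g h : k) : Walg k g h :=
  RingQuot.mkAlgHom k (Wrel k g h) (Yf k)

/-- The image of `w` in the `W`-presentation. -/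
def Ww (k : Type*) [Field k] (g h : k) : Walg k g h :=
  RingQuot.mkAlgHom k (Wrel k g h) (Wf k)

section Lifts

variable {k R : Type*} [Field k] [Ring R] [Algebra k R]

/-- The images of the generators of `k⟨x,y,z⟩` determine a map out of the presentation `T`. -/
lemma exists_Talg_algHom {a b c d e f A B C D E F : k} {x y z : R} (hxy : x * y = y * x)
    (hzx : z * x = a • x ^ 2 + b • (x * y) + c • y ^ 2 + d • (x * z) + e • (y * z) + f • z ^ 2)
    (hzy : z * y = A • x ^ 2 + B • (x * y) + C • y ^ 2 + D • (x * z) + E • (y * z) + F • z ^ 2) :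
    ∃ φ : Talg k a b c d e f A B C D E F →ₐ[k] R,
      φ (Tx k a b c d e f A B C D E F) = x ∧ φ (Ty k a b c d e f A B C D E F) = y ∧
        φ (Tz k a b c d e f A B C D E F) = z := by
  refine ⟨RingQuot.liftAlgHom k ⟨FreeAlgebra.lift k ![x, y, z], ?_⟩, ?_, ?_, ?_⟩
  · rintro _ _ (⟨rfl, rfl⟩ | ⟨rfl, rfl⟩ | ⟨rfl, rfl⟩) <;> simpa [Xf, Yf, Zf]
  all_goals simp [Tx, Ty, Tz, Xf, Yf, Zf]

/-- The images of the generators of `k⟨x,y,w⟩` determine a map out of the `W`-presentation. -/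
lemma exists_Walg_algHom {g h : k} {x y w : R} (hwy : w * y + y * w = x ^ 2 + g • y ^ 2)
    (hw : w ^ 2 = -(h • y ^ 2)) (hxy : x * y = y * x) :
    ∃ φ : Walg k g h →ₐ[k] R, φ (Wx k g h) = x ∧ φ (Wy k g h) = y ∧ φ (Ww k g h) = w := by
  refine ⟨RingQuot.liftAlgHom k ⟨FreeAlgebra.lift k ![x, y, w], ?_⟩, ?_, ?_, ?_⟩
  · rintro _ _ (⟨rfl, rfl⟩ | ⟨rfl, rfl⟩ | ⟨rfl, rfl⟩) <;> simpa [Xf, Yf, Wf]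
  all_goals simp [Wx, Wy, Ww, Xf, Yf, Wf]

/-- Algebra maps out of the presentation `T` agree if they agree on the generators. -/
lemma Talg_algHom_ext {a b c d e f A B C D E F : k}
    {φ ψ : Talg k a b c d e f A B C D E F →ₐ[k] R}
    (hx : φ (Tx k a b c d e f A B C D E F) = ψ (Tx k a b c d e f A B C D E F))
    (hy : φ (Ty k a b c d e f A B C D E F) = ψ (Ty k a b c d e f A B C D E F))
    (hz : φ (Tz k a b c d e f A B C D E F) = ψ (Tz k a b c d e f A B C D E F)) : φ = ψ := by
  refine RingQuot.ringQuot_ext' k _ _ (FreeAlgebra.hom_ext (funext fun i => ?_))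
  fin_cases i
  exacts [hx, hy, hz]

/-- Algebra maps out of the `W`-presentation agree if they agree on the generators. -/
lemma Walg_algHom_ext {g h : k} {φ ψ : Walg k g h →ₐ[k] R}
    (hx : φ (Wx k g h) = ψ (Wx k g h)) (hy : φ (Wy k g h) = ψ (Wy k g h))
    (hw : φ (Ww k g h) = ψ (Ww k g h)) : φ = ψ := by
  refine RingQuot.ringQuot_ext' k _ _ (FreeAlgebra.hom_ext (funext fun i => ?_))
  fin_cases i
  exacts [hx, hy, hw]

end Lifts

section Relations

variable (k : Type*) [Field k]

lemma Talg_relations (a b c d e f A B C D E F : k) {x y z : Talg k a b c d e f A B C D E F}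
    (hx : x = Tx k a b c d e f A B C D E F) (hy : y = Ty k a b c d e f A B C D E F)
    (hz : z = Tz k a b c d e f A B C D E F) :
    x * y = y * x ∧
    z * x = a • x ^ 2 + b • (x * y) + c • y ^ 2 + d • (x * z) + e • (y * z) + f • z ^ 2 ∧
    z * y = A • x ^ 2 + B • (x * y) + C • y ^ 2 + D • (x * z) + E • (y * z) + F • z ^ 2 := by
  subst hx hy hz
  simp only [Tx, Ty, Tz, ← map_mul, ← map_pow, ← map_smul, ← map_add]
  exact ⟨RingQuot.mkAlgHom_rel k (.inl ⟨rfl, rfl⟩),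
    RingQuot.mkAlgHom_rel k (.inr (.inl ⟨rfl, rfl⟩)),
    RingQuot.mkAlgHom_rel k (.inr (.inr ⟨rfl, rfl⟩))⟩

lemma Walg_relations (g h : k) {x y w : Walg k g h}
    (hx : x = Wx k g h) (hy : y = Wy k g h) (hw : w = Ww k g h) :
    w * y + y * w = x ^ 2 + g • y ^ 2 ∧ w ^ 2 = -(h • y ^ 2) ∧ x * y = y * x := by
  subst hx hy hw
  simp only [Wx, Wy, Ww, ← map_mul, ← map_pow, ← map_smul, ← map_add, ← map_neg]
  exact ⟨RingQuot.mkAlgHom_rel k (.inl ⟨rfl, rfl⟩),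
    RingQuot.mkAlgHom_rel k (.inr (.inl ⟨rfl, rfl⟩)),
    RingQuot.mkAlgHom_rel k (.inr (.inr ⟨rfl, rfl⟩))⟩

end Relations

section ChangeOfVariables

variable {k R : Type*} [Field k] [Ring R] [Algebra k R]

/-- The change of variables turns the relations of `T` into those of the `W`-presentation. -/
lemma Walg_relations_of_Talg_relations (h2 : (2 : k) ≠ 0) {a c B C : k} {x y z : R}
    (hxy : x * y = y * x)
    (hzx : z * x = a • x ^ 2 + ((1 - a) * (2 - B)) • (x * y) + c • y ^ 2 + (-1 : k) • (x * z) +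
      (0 : k) • (y * z) + (1 : k) • z ^ 2)
    (hzy : z * y = (1 : k) • x ^ 2 + B • (x * y) + C • y ^ 2 + (0 : k) • (x * z) +
      (-1 : k) • (y * z) + (0 : k) • z ^ 2) :
    (-x + (a - 1) • y + z) * y + y * (-x + (a - 1) • y + z) =
        (x - ((2 - B) / 2) • y) ^ 2 + ((C + 2 * (a - 1)) - (2 - B) ^ 2 / 4) • y ^ 2 ∧
      (-x + (a - 1) • y + z) ^ 2 = -((c - (a - 1) * (C + a - 1)) • y ^ 2) ∧
      (x - ((2 - B) / 2) • y) * y = y * (x - ((2 - B) / 2) • y) := by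
  have h4 : (4 : k) ≠ 0 := by
    rw [show (4 : k) = 2 * 2 by norm_num]; exact mul_ne_zero h2 h2
  simp only [pow_two, mul_add, add_mul, mul_sub, sub_mul, mul_neg, neg_mul, smul_mul_assoc,
    mul_smul_comm, smul_add, smul_sub, smul_neg] at *
  rw [hzy, hzx, hxy]
  refine ⟨?_, ?_, ?_⟩ <;> match_scalars <;> field_simp <;> ring

/-- The inverse change of variables turns the relations of the `W`-presentation into those
of `T`. -/
lemma Talg_relations_of_Walg_relations (h2 : (2 : k) ≠ 0) {a c B C : k} {x y w : R}
    (hwy : w * y + y * w = x ^ 2 + ((C + 2 * (a - 1)) - (2 - B) ^ 2 / 4) • y ^ 2)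
    (hw : w ^ 2 = -((c - (a - 1) * (C + a - 1)) • y ^ 2)) (hxy : x * y = y * x)
    {x' z : R} (hx' : x' = x + ((2 - B) / 2) • y) (hz : z = w + x' - (a - 1) • y) :
    x' * y = y * x' ∧
    z * x' = a • x' ^ 2 + ((1 - a) * (2 - B)) • (x' * y) + c • y ^ 2 + (-1 : k) • (x' * z) +
      (0 : k) • (y * z) + (1 : k) • z ^ 2 ∧
    z * y = (1 : k) • x' ^ 2 + B • (x' * y) + C • y ^ 2 + (0 : k) • (x' * z) +
      (-1 : k) • (y * z) + (0 : k) • z ^ 2 := by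
  have h4 : (4 : k) ≠ 0 := by
    rw [show (4 : k) = 2 * 2 by norm_num]; exact mul_ne_zero h2 h2
  subst hz hx'
  rw [← eq_sub_iff_add_eq] at hwy
  simp only [pow_two, mul_add, add_mul, mul_sub, sub_mul, smul_mul_assoc,
    mul_smul_comm, smul_add, smul_sub] at *
  rw [hwy, hw, hxy]
  refine ⟨?_, ?_, ?_⟩ <;> match_scalars <;> field_simp <;> ring

end ChangeOfVariables

/-- Change of presentation (Lemma 5.2): with `β = 2-B`, `γ = C + 2(a-1)`, `g = γ - β²/4`,
`h = c - (a-1)(C+a-1)`, there is a `k`-algebra isomorphism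
`k⟨x,y,w⟩/⟨wy + yw - x² - g·y², w² + h·y², xy - yx⟩ ≃ T(a, (1-a)(2-B), c, -1, 0, 1; 1, B, C, 0, -1, 0)`
induced by the change of variables `x ↦ x - (β/2)·y`, `y ↦ y`, `w ↦ -x + (a-1)·y + z`. -/
theorem stmt17 {k : Type*} [Field k] [IsAlgClosed k] (hchar : ringChar k ≠ 2)
    (a c B C : k) :
    ∃ φ : Walg k ((C + 2 * (a - 1)) - (2 - B) ^ 2 / 4) (c - (a - 1) * (C + a - 1)) ≃ₐ[k]
        Talg k a ((1 - a) * (2 - B)) c (-1) 0 1 1 B C 0 (-1) 0,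
      φ (Wx k ((C + 2 * (a - 1)) - (2 - B) ^ 2 / 4) (c - (a - 1) * (C + a - 1))) =
          Tx k a ((1 - a) * (2 - B)) c (-1) 0 1 1 B C 0 (-1) 0 -
            ((2 - B) / 2) • Ty k a ((1 - a) * (2 - B)) c (-1) 0 1 1 B C 0 (-1) 0 ∧
      φ (Wy k ((C + 2 * (a - 1)) - (2 - B) ^ 2 / 4) (c - (a - 1) * (C + a - 1))) =
          Ty k a ((1 - a) * (2 - B)) c (-1) 0 1 1 B C 0 (-1) 0 ∧
      φ (Ww k ((C + 2 * (a - 1)) - (2 - B) ^ 2 / 4) (c - (a - 1) * (C + a - 1))) =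
          -Tx k a ((1 - a) * (2 - B)) c (-1) 0 1 1 B C 0 (-1) 0 +
            (a - 1) • Ty k a ((1 - a) * (2 - B)) c (-1) 0 1 1 B C 0 (-1) 0 +
            Tz k a ((1 - a) * (2 - B)) c (-1) 0 1 1 B C 0 (-1) 0 := by
  have h2 : (2 : k) ≠ 0 := Ring.two_ne_zero hchar
  obtain ⟨hxy, hzx, hzy⟩ :=
    Talg_relations k a ((1 - a) * (2 - B)) c (-1) 0 1 1 B C 0 (-1) 0 rfl rfl rfl
  obtain ⟨hwy, hw, hxy'⟩ := Walg_relations_of_Talg_relations h2 hxy hzx hzy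
  obtain ⟨φ, φx, φy, φw⟩ := exists_Walg_algHom hwy hw hxy'
  obtain ⟨rwy, rww, rxy⟩ := Walg_relations k ((C + 2 * (a - 1)) - (2 - B) ^ 2 / 4)
    (c - (a - 1) * (C + a - 1)) rfl rfl rfl
  obtain ⟨sxy, szx, szy⟩ := Talg_relations_of_Walg_relations h2 rwy rww rxy rfl rfl
  obtain ⟨ψ, ψx, ψy, ψz⟩ := exists_Talg_algHom sxy szx szy
  refine ⟨AlgEquiv.ofAlgHom φ ψ (Talg_algHom_ext ?_ ?_ ?_) (Walg_algHom_ext ?_ ?_ ?_),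
    φx, φy, φw⟩
  all_goals
    simp only [AlgHom.comp_apply, AlgHom.id_apply, map_add, map_sub, map_neg, map_smul,
      φx, φy, φw, ψx, ψy, ψz]
  all_goals module
end
end
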